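/- (Putinar-type Positivstellensatz for bounded spectrahedra) Let A be a linear pencil of symmetric α×α matrices such that S_A is bounded. If f ∈ ℝ[x] satisfies f(x) > 0 for all x ∈ S_A, then f ∈ M_A, i.e., f = s + Σ_i v_i^* A v_i for some sum of squares s and v_i ∈ ℝ[x]^α. -/

import Mathlib

open MvPolynomial Matrix
attribute [local instance] Matrix.frobeniusNormedAddCommGroup

noncomputable section

abbrev RP (n : ℕ) := MvPolynomial (Fin n) ℝ

/-- Evaluation of the linear pencil `A₀ + ∑ xᵢ Aᵢ` at a point `x ∈ ℝⁿ`. -/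
def pencilEval {n α : ℕ} (A0 : Matrix (Fin α) (Fin α) ℝ) (A : Fin n → Matrix (Fin α) (Fin α) ℝ)
    (x : Fin n → ℝ) : Matrix (Fin α) (Fin α) ℝ :=
  A0 + ∑ i, x i • A i

/-- The linear pencil `A₀ + ∑ xᵢ Aᵢ` as a matrix of polynomials. -/
def pencilPoly {n α : ℕ} (A0 : Matrix (Fin α) (Fin α) ℝ) (A : Fin n → Matrix (Fin α) (Fin α) ℝ) :
    Matrix (Fin α) (Fin α) (RP n) :=
  A0.map C + ∑ i, (X i : RP n) • (A i).map C

/-- `v^* M v` for a matrix of polynomials. -/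
def quadForm {n α : ℕ} (M : Matrix (Fin α) (Fin α) (RP n)) (v : Fin α → RP n) : RP n :=
  v ⬝ᵥ (M *ᵥ v)

/-- A sum of squares of polynomials. -/
def IsSos {n : ℕ} (p : RP n) : Prop := ∃ (k : ℕ) (q : Fin k → RP n), p = ∑ i, q i ^ 2

/-- An sos-matrix: a finite sum `∑ vⱼ vⱼ^*` with `vⱼ` vectors of polynomials. -/
def IsSosMatrix {n α : ℕ} (S : Matrix (Fin α) (Fin α) (RP n)) : Prop :=
  ∃ (k : ℕ) (v : Fin k → Fin α → RP n), S = ∑ j, Matrix.vecMulVec (v j) (v j)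

/-- Membership in the quadratic module `M_A` associated to the pencil. -/
def InQuadModule {n α : ℕ} (A0 : Matrix (Fin α) (Fin α) ℝ)
    (A : Fin n → Matrix (Fin α) (Fin α) ℝ) (p : RP n) : Prop :=
  ∃ s, IsSos s ∧ ∃ (k : ℕ) (v : Fin k → Fin α → RP n),
    p = s + ∑ j, quadForm (pencilPoly A0 A) (v j)

/-- Strong infeasibility: positive distance (Frobenius norm) between the range of the
pencil and the PSD cone. -/
def StronglyInfeasible {n α : ℕ} (A0 : Matrix (Fin α) (Fin α) ℝ)
    (A : Fin n → Matrix (Fin α) (Fin α) ℝ) : Prop :=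
  ∃ ε > (0:ℝ), ∀ (x : Fin n → ℝ) (B : Matrix (Fin α) (Fin α) ℝ), B.PosSemidef →
    ε ≤ dist (pencilEval A0 A x) B

structure QM {n : ℕ} (M : Set (RP n)) : Prop where
  sq : ∀ q, q ^ 2 ∈ M
  add : ∀ p q, p ∈ M → q ∈ M → p + q ∈ M
  mul : ∀ q m, m ∈ M → q ^ 2 * m ∈ M

lemma half_eq (n : ℕ) : (C (1/2) : RP n) * 2 = 1 := by
  have : (2 : RP n) = C 2 := (map_ofNat C 2).symm
  rw [this, ← C_mul]; norm_num

namespace QM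
variable {n : ℕ} {M : Set (RP n)}

lemma zero (h : QM M) : 0 ∈ M := by simpa using h.sq 0
lemma one (h : QM M) : 1 ∈ M := by simpa using h.sq 1

lemma smul (h : QM M) {c : ℝ} (hc : 0 ≤ c) {m : RP n} (hm : m ∈ M) : C c * m ∈ M := by
  have := h.mul (C (Real.sqrt c)) m hm
  rwa [← C_pow, Real.sq_sqrt hc] at this

lemma const (h : QM M) {c : ℝ} (hc : 0 ≤ c) : C c ∈ M := by
  simpa using h.smul hc h.one

lemma sum (h : QM M) {ι : Type*} (s : Finset ι) (g : ι → RP n) (hg : ∀ i ∈ s, g i ∈ M) :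
    ∑ i ∈ s, g i ∈ M := by
  classical
  induction s using Finset.induction_on with
  | empty => simpa using h.zero
  | insert a s ha ih =>
    rw [Finset.sum_insert ha]
    exact h.add _ _ (hg a (by simp)) (ih fun i hi => hg i (by simp [hi]))

/-- The support of `M` is an ideal. -/
lemma supp_mul (h : QM M) {m : RP n} (h1 : m ∈ M) (h2 : -m ∈ M) (r : RP n) : r * m ∈ M := by
  have e : r * m = (C (1/2) * (r + 1)) ^ 2 * m + (C (1/2) * (r - 1)) ^ 2 * (-m) := by
    linear_combination (-(C (1/2) * 2 + 1) * r * m) * half_eq n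
  rw [e]
  exact h.add _ _ (h.mul _ _ h1) (h.mul _ _ h2)

lemma all_of_neg_one (h : QM M) (h1 : -1 ∈ M) (r : RP n) : r ∈ M := by
  simpa using h.supp_mul h.one h1 r

/-- multiplying by a sum of squares -/
lemma sos_mul (h : QM M) {s m : RP n} (hs : IsSos s) (hm : m ∈ M) : s * m ∈ M := by
  obtain ⟨k, q, rfl⟩ := hs
  rw [Finset.sum_mul]
  exact h.sum _ _ fun i _ => h.mul _ _ hm

lemma sos_mem (h : QM M) {s : RP n} (hs : IsSos s) : s ∈ M := by
  simpa using h.sos_mul hs h.one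

end QM

lemma IsSos.add {n : ℕ} {p q : RP n} (hp : IsSos p) (hq : IsSos q) : IsSos (p + q) := by
  obtain ⟨k, a, rfl⟩ := hp
  obtain ⟨l, b, rfl⟩ := hq
  refine ⟨k + l, Fin.append a b, ?_⟩
  simp [Fin.sum_univ_add]

lemma IsSos.sq {n : ℕ} (q : RP n) : IsSos (q ^ 2) := ⟨1, fun _ => q, by simp⟩
lemma IsSos.zero {n : ℕ} : IsSos (0 : RP n) := ⟨0, fun _ => 0, by simp⟩

lemma IsSos.sq_mul {n : ℕ} (q : RP n) {p : RP n} (hp : IsSos p) : IsSos (q ^ 2 * p) := by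
  obtain ⟨k, a, rfl⟩ := hp
  exact ⟨k, fun i => q * a i, by simp [Finset.mul_sum, mul_pow]⟩

lemma quadForm_smul {n α : ℕ} (P : Matrix (Fin α) (Fin α) (RP n)) (q : RP n) (v : Fin α → RP n) :
    quadForm P (q • v) = q ^ 2 * quadForm P v := by
  simp only [quadForm, Matrix.mulVec_smul, dotProduct_smul, smul_dotProduct, smul_eq_mul]
  ring

lemma qm_pencil {n α : ℕ} (A0 : Matrix (Fin α) (Fin α) ℝ) (A : Fin n → Matrix (Fin α) (Fin α) ℝ) :
    QM {p | InQuadModule A0 A p} where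
  sq q := ⟨q ^ 2, IsSos.sq q, 0, fun _ => 0, by simp⟩
  add p q := by
    rintro ⟨s, hs, k, v, rfl⟩ ⟨t, ht, l, w, rfl⟩
    refine ⟨s + t, hs.add ht, k + l, Fin.append v w, ?_⟩
    simp [Fin.sum_univ_add]
    ring
  mul q m := by
    rintro ⟨s, hs, k, v, rfl⟩
    refine ⟨q ^ 2 * s, hs.sq_mul q, k, fun j => q • v j, ?_⟩
    simp [quadForm_smul, Finset.mul_sum, mul_add]

lemma quadForm_mem {n α : ℕ} (A0 : Matrix (Fin α) (Fin α) ℝ)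
    (A : Fin n → Matrix (Fin α) (Fin α) ℝ) (v : Fin α → RP n) :
    InQuadModule A0 A (quadForm (pencilPoly A0 A) v) :=
  ⟨0, IsSos.zero, 1, fun _ => v, by simp⟩

/-- extension by an element -/
lemma qm_adjoin {n : ℕ} {M : Set (RP n)} (h : QM M) (p : RP n) :
    QM {r | ∃ m ∈ M, ∃ s, IsSos s ∧ r = m + s * p} where
  sq q := ⟨q ^ 2, h.sq q, 0, IsSos.zero, by simp⟩
  add := by
    rintro _ _ ⟨m, hm, s, hs, rfl⟩ ⟨m', hm', s', hs', rfl⟩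
    exact ⟨m + m', h.add _ _ hm hm', s + s', hs.add hs', by ring⟩
  mul := by
    rintro q _ ⟨m, hm, s, hs, rfl⟩
    exact ⟨q ^ 2 * m, h.mul _ _ hm, q ^ 2 * s, hs.sq_mul q, by ring⟩

lemma qm_ideal {n : ℕ} {M : Set (RP n)} (h : QM M) (p : RP n) :
    QM {r | ∃ m ∈ M, ∃ s, r = m + s * p} where
  sq q := ⟨q ^ 2, h.sq q, 0, by simp⟩
  add := by
    rintro _ _ ⟨m, hm, s, rfl⟩ ⟨m', hm', s', rfl⟩
    exact ⟨m + m', h.add _ _ hm hm', s + s', by ring⟩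
  mul := by
    rintro q _ ⟨m, hm, s, rfl⟩
    exact ⟨q ^ 2 * m, h.mul _ _ hm, q ^ 2 * s, by ring⟩

/-- Maximal proper quadratic modules. -/
structure MaxQM {n : ℕ} (M : Set (RP n)) : Prop extends QM M where
  proper : -1 ∉ M
  max : ∀ M', QM M' → M ⊆ M' → -1 ∉ M' → M' ⊆ M

lemma exists_max {n : ℕ} {M : Set (RP n)} (h : QM M) (hp : -1 ∉ M) :
    ∃ M', M ⊆ M' ∧ MaxQM M' := by
  obtain ⟨M', hM', hmax⟩ := zorn_subset_nonempty {T : Set (RP n) | QM T ∧ -1 ∉ T} (by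
    intro c hc hchain ⟨t, ht⟩
    refine ⟨⋃₀ c, ⟨⟨?_, ?_, ?_⟩, ?_⟩, fun s hs => Set.subset_sUnion_of_mem hs⟩
    · intro q; exact ⟨t, ht, (hc ht).1.sq q⟩
    · rintro p q ⟨a, ha, hpa⟩ ⟨b, hb, hqb⟩
      rcases hchain.total ha hb with hab | hab
      · exact ⟨b, hb, (hc hb).1.add _ _ (hab hpa) hqb⟩
      · exact ⟨a, ha, (hc ha).1.add _ _ hpa (hab hqb)⟩
    · rintro q m ⟨a, ha, hma⟩
      exact ⟨a, ha, (hc ha).1.mul _ _ hma⟩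
    · rintro ⟨a, ha, hma⟩
      exact (hc ha).2 hma) M ⟨h, hp⟩
  refine ⟨M', hM', ⟨hmax.prop.1, hmax.prop.2, fun M'' h1 h2 h3 => ?_⟩⟩
  exact hmax.le_of_ge ⟨h1, h3⟩ h2

namespace MaxQM
variable {n : ℕ} {M : Set (RP n)}

lemma neg_one_of_notMem (h : MaxQM M) {p : RP n} (hp : p ∉ M) :
    ∃ m ∈ M, ∃ s, IsSos s ∧ -1 = m + s * p := by
  by_contra hcon
  refine hp (h.max _ (qm_adjoin h.toQM p) ?_ hcon ⟨0, h.zero, 1, by simpa using IsSos.sq 1, by simp⟩)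
  intro m hm
  exact ⟨m, hm, 0, IsSos.zero, by simp⟩

lemma total (h : MaxQM M) (p : RP n) : p ∈ M ∨ -p ∈ M := by
  by_contra! hcon
  obtain ⟨m1, hm1, s1, hs1, e1⟩ := h.neg_one_of_notMem hcon.1
  obtain ⟨m2, hm2, s2, hs2, e2⟩ := h.neg_one_of_notMem hcon.2
  have hneg : -s1 ∈ M := by
    have e : -s1 = s2 + s2 * m1 + s1 * m2 := by
      linear_combination s2 * e1 + s1 * e2
    rw [e]
    exact h.add _ _ (h.add _ _ (h.sos_mem hs2) (h.sos_mul hs2 hm1)) (h.sos_mul hs1 hm2)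
  apply h.proper
  rw [e1]
  refine h.add _ _ hm1 ?_
  rw [mul_comm]
  exact h.supp_mul (h.sos_mem hs1) hneg p

lemma supp_of_sq (h : MaxQM M) {l : RP n} (hl : -l ^ 2 ∈ M) : l ∈ M := by
  by_contra hcon
  have : -1 ∈ {r | ∃ m ∈ M, ∃ s, r = m + s * l} := by
    by_contra hc
    refine hcon (h.max _ (qm_ideal h.toQM l) ?_ hc ⟨0, h.zero, 1, by simp⟩)
    intro m hm
    exact ⟨m, hm, 0, by simp⟩
  obtain ⟨m, hm, g, e⟩ := this
  apply h.proper
  have e2 : -1 = g ^ 2 * (-l ^ 2) + (m + m) + m ^ 2 := by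
    linear_combination (-g * l + 1 + m) * e
  rw [e2]
  exact h.add _ _ (h.add _ _ (h.mul _ _ hl) (h.add _ _ hm hm)) (h.sq m)

end MaxQM

/-- bounded elements -/
def Bd {n : ℕ} (M : Set (RP n)) (p : RP n) : Prop := ∃ N : ℝ, 0 < N ∧ C N - p ∈ M ∧ C N + p ∈ M

/-- infinitesimal elements -/
def Infl {n : ℕ} (M : Set (RP n)) (p : RP n) : Prop :=
  ∀ e : ℝ, 0 < e → C e - p ∈ M ∧ C e + p ∈ M

section arch
variable {n : ℕ} {M : Set (RP n)}

lemma C_rel {a b : ℝ} (h : a = b) : (C a : RP n) = C b := by rw [h]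

lemma sq_bound (h : QM M) {N : ℝ} (hN : 0 < N) {p : RP n} (h1 : C N - p ∈ M) (h2 : C N + p ∈ M) :
    C (N ^ 2) - p ^ 2 ∈ M := by
  have e : C (N ^ 2) - p ^ 2 =
      C (1 / (2 * N)) * ((C N - p) ^ 2 * (C N + p) + (C N + p) ^ 2 * (C N - p)) := by
    have r : (C (1 / (2 * N)) : RP n) * C N * 2 = 1 := by
      rw [← map_ofNat (C : ℝ →+* RP n) 2, ← C_mul, ← C_mul, ← C_1]
      exact C_rel (by field_simp)
    rw [C_pow]
    linear_combination (p ^ 2 - C N ^ 2) * r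
  rw [e]
  exact h.smul (by positivity) (h.add _ _ (h.mul _ _ h2) (h.mul _ _ h1))

lemma Bd.const (h : QM M) (c : ℝ) : Bd M (C c : RP n) := by
  refine ⟨|c| + 1, by positivity, ?_, ?_⟩
  · rw [← C_sub]; exact h.const (by linarith [le_abs_self c])
  · rw [← C_add]; exact h.const (by linarith [neg_abs_le c])

lemma Bd.neg {p : RP n} (hp : Bd M p) : Bd M (-p) := by
  obtain ⟨N, hN, h1, h2⟩ := hp
  exact ⟨N, hN, by simpa using h2, by simpa [sub_eq_add_neg] using h1⟩

lemma Bd.add (h : QM M) {p q : RP n} (hp : Bd M p) (hq : Bd M q) : Bd M (p + q) := by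
  obtain ⟨N, hN, h1, h2⟩ := hp
  obtain ⟨K, hK, h3, h4⟩ := hq
  refine ⟨N + K, by positivity, ?_, ?_⟩
  · convert h.add _ _ h1 h3 using 1
    rw [C_add]; ring
  · convert h.add _ _ h2 h4 using 1
    rw [C_add]; ring

lemma Bd.half_mul (h : QM M) {p q : RP n} (hp : Bd M p) (hq : Bd M q) :
    ∃ N : ℝ, 0 < N ∧ C N + p * q ∈ M := by
  obtain ⟨N, hN, h1, h2⟩ := hp.add h hq.neg
  refine ⟨N ^ 2 / 4, by positivity, ?_⟩
  have := h.smul (c := 1 / 4) (by norm_num) (h.add _ _ (sq_bound h hN h1 h2) (h.sq (p + q)))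
  convert this using 1
  have r : (C (1 / 4) : RP n) * 4 = 1 := by
    rw [← map_ofNat (C : ℝ →+* RP n) 4, ← C_mul, ← C_1]
    exact C_rel (by norm_num)
  have r2 : (C (N ^ 2 / 4) : RP n) = C (1 / 4) * C (N ^ 2) := by
    rw [← C_mul]; exact C_rel (by ring)
  rw [r2]
  linear_combination (-p * q) * r

lemma Bd.mono (h : QM M) {N K : ℝ} (hNK : N ≤ K) {p : RP n} (hp : C N + p ∈ M) : C K + p ∈ M := by
  convert h.add _ _ (h.const (sub_nonneg.2 hNK)) hp using 1
  rw [C_sub]; ring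

lemma Bd.mul (h : QM M) {p q : RP n} (hp : Bd M p) (hq : Bd M q) : Bd M (p * q) := by
  obtain ⟨N, hN, h1⟩ := hp.half_mul h hq
  obtain ⟨K, hK, h2⟩ := hp.half_mul h hq.neg
  refine ⟨max N K, lt_max_of_lt_left hN, ?_, Bd.mono h (le_max_left _ _) h1⟩
  have := Bd.mono h (le_max_right N K) h2
  convert this using 1
  ring

lemma bd_all (h : QM M) (hX : ∀ i, Bd M (X i : RP n)) (p : RP n) : Bd M p := by
  induction p using MvPolynomial.induction_on with
  | C a => exact Bd.const h a
  | add p q hp hq => exact hp.add h hq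
  | mul_X p i hp => exact hp.mul h (hX i)

lemma Infl.add (h : QM M) {p q : RP n} (hp : Infl M p) (hq : Infl M q) : Infl M (p + q) := by
  intro e he
  obtain ⟨h1, h2⟩ := hp (e / 2) (by positivity)
  obtain ⟨h3, h4⟩ := hq (e / 2) (by positivity)
  have r : (C e : RP n) = C (e / 2) + C (e / 2) := by rw [← C_add]; exact C_rel (by ring)
  constructor
  · convert h.add _ _ h1 h3 using 1
    rw [r]; ring
  · convert h.add _ _ h2 h4 using 1
    rw [r]; ring

lemma Infl.zero (h : QM M) : Infl M (0 : RP n) := by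
  intro e he
  simpa using h.const he.le

lemma Infl.half_mul (h : QM M) {p q : RP n} (hp : Infl M p) (hq : Bd M q) (e : ℝ) (he : 0 < e) :
    C e + p * q ∈ M := by
  obtain ⟨N, hN, h1, h2⟩ := hq
  obtain ⟨h3, h4⟩ := hp (e / N) (by positivity)
  have k1 := sq_bound h hN h1 h2
  have k2 := sq_bound h (by positivity) h3 h4
  set t : ℝ := N ^ 2 / (2 * e) with ht
  have htp : 0 < t := by positivity
  have m1 := h.smul htp.le k2
  have m2 := h.smul (c := 1 / (4 * t)) (by positivity) k1
  have m3 := h.smul htp.le (h.sq (p + C (1 / (2 * t)) * q))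
  convert h.add _ _ (h.add _ _ m1 m2) m3 using 1
  have r1 : (C t : RP n) * C ((e / N) ^ 2) = C (e / 2) := by
    rw [← C_mul]; exact C_rel (by rw [ht]; field_simp)
  have r2 : (C (1 / (4 * t)) : RP n) * C (N ^ 2) = C (e / 2) := by
    rw [← C_mul]; exact C_rel (by rw [ht]; field_simp; norm_num)
  have r3 : (C e : RP n) = C (e / 2) + C (e / 2) := by rw [← C_add]; exact C_rel (by ring)
  have r4 : (C t : RP n) * C (1 / (2 * t)) * 2 = 1 := by
    rw [← map_ofNat (C : ℝ →+* RP n) 2, ← C_mul, ← C_mul, ← C_1]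
    exact C_rel (by field_simp)
  have r5 : (C t : RP n) * C (1 / (2 * t)) ^ 2 = C (1 / (4 * t)) := by
    rw [← C_pow, ← C_mul]
    exact C_rel (by field_simp; norm_num)
  rw [r3]
  linear_combination -r1 - r2 - p * q * r4 - q ^ 2 * r5

lemma Infl.mul (h : QM M) {p q : RP n} (hp : Infl M p) (hq : Bd M q) : Infl M (p * q) := by
  intro e he
  refine ⟨?_, hp.half_mul h hq e he⟩
  have := hp.half_mul h hq.neg e he
  convert this using 1
  ring

/-- For a maximal archimedean quadratic module there is a real point. -/
lemma MaxQM.exists_point (h : MaxQM M) (hX : ∀ i, Bd M (X i : RP n)) :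
    ∃ x : Fin n → ℝ, ∀ m ∈ M, 0 ≤ eval x m := by
  have hneg : ∀ c : ℝ, c < 0 → (C c : RP n) ∉ M := by
    intro c hc hm
    apply h.proper
    have := h.smul (c := (-c)⁻¹) (by simpa using hc.le) hm
    rw [← C_mul] at this
    convert this using 1
    rw [← C_1, ← C_neg]
    exact C_rel (by rw [inv_neg, neg_mul, inv_mul_cancel₀ hc.ne])
  have key : ∀ p : RP n, Bd M p → ∃ a : ℝ, Infl M (p - C a) := by
    rintro p ⟨N, hN, h1, h2⟩
    set S : Set ℝ := {r | p - C r ∈ M} with hS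
    have hne : S.Nonempty := ⟨-N, by simpa [hS, add_comm] using h2⟩
    have hbd : BddAbove S := by
      refine ⟨N, fun r hr => ?_⟩
      by_contra! hlt
      refine hneg (N - r) (by linarith) ?_
      convert h.add _ _ h1 hr using 1
      rw [C_sub]; ring
    refine ⟨sSup S, fun e he => ⟨?_, ?_⟩⟩
    · have : p - C (sSup S + e) ∉ M := fun hm => by
        have := le_csSup hbd (show sSup S + e ∈ S from hm)
        linarith
      have := (h.total _).resolve_left this
      convert this using 1
      rw [C_add]; ring
    · obtain ⟨r, hr, hlt⟩ := exists_lt_of_lt_csSup hne (show sSup S - e < sSup S by linarith)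
      convert h.add _ _ hr (h.const (show 0 ≤ r - (sSup S - e) by linarith)) using 1
      simp only [C_sub]; ring
  choose x hx using fun i => key _ (hX i)
  have hev : ∀ p : RP n, Infl M (p - C (eval x p)) := by
    intro p
    induction p using MvPolynomial.induction_on with
    | C a => simpa using Infl.zero h.toQM
    | add p q hp hq =>
      convert hp.add h.toQM hq using 1
      simp only [map_add]; ring
    | mul_X p i hp =>
      convert (hp.mul h.toQM (hX i)).add h.toQM
        ((hx i).mul h.toQM (Bd.const h.toQM (eval x p))) using 1
      simp only [map_mul, eval_X]; ring
  refine ⟨x, fun m hm => ?_⟩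
  by_contra! hlt
  have h1 := (hev m (-(eval x m) / 2) (by linarith)).1
  refine hneg (eval x m / 2) (by linarith) ?_
  convert h.add _ _ h1 hm using 1
  have r : (C (-(eval x m) / 2) : RP n) = C (eval x m / 2) - C (eval x m) := by
    rw [← C_sub]; exact C_rel (by ring)
  rw [r]; ring

lemma arch_step (h : QM M) (hX : ∀ i, Bd M (X i : RP n)) (f s m : RP n) (hs : IsSos s)
    (hm : m ∈ M) (e : s * f = 1 + m) : f ∈ M := by
  obtain ⟨N1, hN1, -, b1⟩ := bd_all h hX f
  obtain ⟨N2, hN2, b2, -⟩ := bd_all h hX s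
  obtain ⟨N3, hN3, b3, -⟩ := bd_all h hX (s ^ 2 * f)
  set k : ℝ := max N2 N3 with hk
  have hkp : 0 < k := lt_max_of_lt_left hN2
  have c2 : C (2 * k) - s ∈ M := by
    rw [sub_eq_add_neg] at b2 ⊢
    exact Bd.mono h (by linarith [le_max_left N2 N3]) b2
  have c3 : C k - s ^ 2 * f ∈ M := by
    rw [sub_eq_add_neg] at b3 ⊢
    exact Bd.mono h (le_max_right N2 N3) b3
  have step : ∀ r : ℝ, 0 ≤ r → C r + f ∈ M → C (r - 1 / k) + f ∈ M := by
    intro r hr hrf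
    have t1 := h.mul (C k - s) _ hrf
    have t2 := h.smul (c := 2 * k) (by positivity) hm
    have t3 := h.smul hr (h.sos_mul hs c2)
    have t := h.smul (c := 1 / k ^ 2) (by positivity)
      (h.add _ _ (h.add _ _ t1 t2) (h.add _ _ t3 c3))
    convert t using 1
    have em : m = s * f - 1 := by rw [e]; ring
    have r1 : (C (1 / k ^ 2) : RP n) * C k ^ 2 = 1 := by
      rw [← C_pow, ← C_mul, ← C_1]; exact C_rel (by field_simp)
    have r2 : (C (1 / k ^ 2) : RP n) * C k = C (1 / k) := by
      rw [← C_mul]; exact C_rel (by field_simp)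
    have r3 : (C (2 * k) : RP n) = 2 * C k := by
      rw [C_mul]; congr 1
    rw [em, r3, C_sub]
    linear_combination (-(C r + f)) * r1 + r2
  have iter : ∀ j : ℕ, C (max 0 (N1 - j * (1 / k))) + f ∈ M := by
    intro j
    induction j with
    | zero => simpa [hN1.le] using b1
    | succ j ih =>
      refine Bd.mono h ?_ (step _ (le_max_left _ _) ih)
      have : 0 < 1 / k := by positivity
      push_cast
      rw [sub_le_iff_le_add]
      refine max_le ?_ ?_
      · have := le_max_left 0 (N1 - (j + 1) * (1 / k)); linarith
      · have := le_max_right 0 (N1 - (j + 1) * (1 / k)); linarith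
  obtain ⟨j, hj⟩ := exists_nat_ge (N1 * k)
  have := iter j
  rw [max_eq_left] at this
  · simpa using this
  · have : N1 ≤ j / k := by rwa [le_div_iff₀ hkp]
    have e : (j : ℝ) * (1 / k) = j / k := by ring
    linarith

lemma putinar (h : QM M) (hX : ∀ i, Bd M (X i : RP n)) (f : RP n)
    (hf : ∀ x : Fin n → ℝ, (∀ m ∈ M, 0 ≤ eval x m) → 0 < eval x f) : f ∈ M := by
  by_cases hT : -1 ∈ {r | ∃ m ∈ M, ∃ s, IsSos s ∧ r = m + s * (-f)}
  · obtain ⟨m, hm, s, hs, e⟩ := hT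
    exact arch_step h hX f s m hs hm (by linear_combination e)
  · exfalso
    obtain ⟨M', hsub, hmax⟩ := exists_max (qm_adjoin h (-f)) hT
    have hMM : M ⊆ M' := fun m hm => hsub ⟨m, hm, 0, IsSos.zero, by simp⟩
    obtain ⟨x, hx⟩ := hmax.exists_point (fun i => by
      obtain ⟨N, hN, h1, h2⟩ := hX i
      exact ⟨N, hN, hMM h1, hMM h2⟩)
    have h1 := hf x fun m hm => hx m (hMM hm)
    have h2 := hx (-f) (hsub ⟨0, h.zero, 1, by simpa using IsSos.sq 1, by simp⟩)
    rw [map_neg] at h2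
    linarith

end arch

lemma sum_emb {ι κ F : Type*} [Fintype ι] [Fintype κ] [AddCommMonoid F] (g : ι ↪ κ) (φ : κ → F)
    (hφ : ∀ j, j ∉ Set.range g → φ j = 0) : ∑ j, φ j = ∑ i, φ (g i) :=
  (Fintype.sum_of_injective g g.injective (fun i => φ (g i)) φ hφ (fun _ => rfl)).symm

lemma compact_hull {E : Type*} [NormedAddCommGroup E] [NormedSpace ℝ E] [FiniteDimensional ℝ E]
    {s : Set E} (hs : IsCompact s) : IsCompact (convexHull ℝ s) := by
  rcases s.eq_empty_or_nonempty with rfl | ⟨p0, hp0⟩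
  · simp
  set d := Module.finrank ℝ E + 1 with hd
  have hK : IsCompact ((stdSimplex ℝ (Fin d)) ×ˢ (Set.univ.pi fun _ : Fin d => s)) :=
    (isCompact_stdSimplex ℝ (Fin d)).prod (isCompact_univ_pi fun _ => hs)
  have hcont : Continuous fun p : (Fin d → ℝ) × (Fin d → E) => ∑ i, p.1 i • p.2 i := by fun_prop
  convert hK.image hcont using 1
  apply Set.Subset.antisymm
  · intro x hx
    obtain ⟨ι, _, z, w, hz, haff, hw, hsum, hx⟩ := eq_pos_convex_span_of_mem_convexHull hx
    have hcard : Fintype.card ι ≤ d := by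
      have := haff.card_le_finrank_succ
      have h2 := Submodule.finrank_le (vectorSpan ℝ (Set.range z))
      omega
    obtain ⟨g⟩ : Nonempty (ι ↪ Fin d) := by
      rw [Function.Embedding.nonempty_iff_card_le]; simpa using hcard
    refine ⟨(fun j => Function.extend g w 0 j, fun j => Function.extend g z (fun _ => p0) j),
      ⟨⟨?_, ?_⟩, ?_⟩, ?_⟩
    · intro j
      by_cases hj : ∃ i, g i = j
      · obtain ⟨i, rfl⟩ := hj
        simpa [g.injective.extend_apply] using (hw i).le
      · simp [Function.extend_apply' _ _ _ hj]
    · rw [sum_emb g]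
      · simpa [g.injective.extend_apply] using hsum
      · intro j hj
        simp [Function.extend_apply' w _ _ hj]
    · intro j _
      by_cases hj : ∃ i, g i = j
      · obtain ⟨i, rfl⟩ := hj
        simpa [g.injective.extend_apply] using hz ⟨i, rfl⟩
      · simpa [Function.extend_apply' z _ _ hj] using hp0
    · simp only
      rw [sum_emb g]
      · simpa [g.injective.extend_apply] using hx
      · intro j hj
        simp [Function.extend_apply' w _ _ hj]
  · rintro _ ⟨⟨w, z⟩, ⟨⟨hw0, hw1⟩, hz⟩, rfl⟩
    exact (convex_convexHull ℝ s).sum_mem (fun i _ => hw0 i) hw1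
      fun i _ => subset_convexHull ℝ s (hz i trivial)

section pencil
variable {n α : ℕ}

/-- affine-linear polynomials -/
def lin (n : ℕ) : (ℝ × (Fin n → ℝ)) →ₗ[ℝ] RP n where
  toFun e := C e.1 + ∑ i, C (e.2 i) * X i
  map_add' e f := by
    simp only [Prod.fst_add, Prod.snd_add, Pi.add_apply, C_add, add_mul, Finset.sum_add_distrib]
    ring
  map_smul' c e := by
    simp only [Prod.smul_fst, Prod.smul_snd, Pi.smul_apply, smul_eq_mul, C_mul, RingHom.id_apply,
      MvPolynomial.smul_eq_C_mul, mul_add, Finset.mul_sum, mul_assoc]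

lemma lin_apply (e : ℝ × (Fin n → ℝ)) : lin n e = C e.1 + ∑ i, C (e.2 i) * X i := rfl

lemma lin_smul (c : ℝ) (e : ℝ × (Fin n → ℝ)) : lin n (c • e) = C c * lin n e := by
  rw [map_smul, MvPolynomial.smul_eq_C_mul]

lemma lin_one : lin n (1, 0) = 1 := by simp [lin_apply]

lemma eval_lin (x : Fin n → ℝ) (e : ℝ × (Fin n → ℝ)) :
    eval x (lin n e) = e.1 + ∑ i, x i * e.2 i := by
  simp [lin_apply, mul_comm]

/-- the coefficients of `b^T A c` -/
def bv (A0 : Matrix (Fin α) (Fin α) ℝ) (A : Fin n → Matrix (Fin α) (Fin α) ℝ) :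
    (Fin α → ℝ) →ₗ[ℝ] (Fin α → ℝ) →ₗ[ℝ] (ℝ × (Fin n → ℝ)) :=
  LinearMap.mk₂ ℝ (fun b c => (b ⬝ᵥ (A0 *ᵥ c), fun i => b ⬝ᵥ (A i *ᵥ c)))
    (by intros; ext <;> simp [add_dotProduct]) (by intros; ext <;> simp)
    (by intros; ext <;> simp [mulVec_add]) (by intros; ext <;> simp [mulVec_smul])

lemma bv_apply (A0 : Matrix (Fin α) (Fin α) ℝ) (A : Fin n → Matrix (Fin α) (Fin α) ℝ)
    (b c : Fin α → ℝ) :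
    bv A0 A b c = (b ⬝ᵥ (A0 *ᵥ c), fun i => b ⬝ᵥ (A i *ᵥ c)) := rfl

lemma bv_symm (A0 : Matrix (Fin α) (Fin α) ℝ) (A : Fin n → Matrix (Fin α) (Fin α) ℝ)
    (hA0 : A0.IsSymm) (hA : ∀ i, (A i).IsSymm) (b c : Fin α → ℝ) :
    bv A0 A b c = bv A0 A c b := by
  have key : ∀ B : Matrix (Fin α) (Fin α) ℝ, B.IsSymm → b ⬝ᵥ (B *ᵥ c) = c ⬝ᵥ (B *ᵥ b) := by
    intro B hB
    rw [dotProduct_mulVec, dotProduct_comm, ← mulVec_transpose, hB.eq]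
  rw [bv_apply, bv_apply]
  ext
  · exact key _ hA0
  · exact key _ (hA _)

lemma map_C_form (B : Matrix (Fin α) (Fin α) ℝ) (b c : Fin α → ℝ) :
    (fun i => (C (b i) : RP n)) ⬝ᵥ (B.map C *ᵥ fun i => C (c i)) = C (b ⬝ᵥ (B *ᵥ c)) := by
  simp [dotProduct, mulVec, map_sum, map_mul]

lemma form_eq_lin (A0 : Matrix (Fin α) (Fin α) ℝ) (A : Fin n → Matrix (Fin α) (Fin α) ℝ)
    (b c : Fin α → ℝ) :
    (fun i => (C (b i) : RP n)) ⬝ᵥ (pencilPoly A0 A *ᵥ fun i => C (c i)) = lin n (bv A0 A b c) := by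
  simp only [pencilPoly, add_mulVec, dotProduct_add, lin_apply, bv_apply, map_C_form]
  congr 1
  rw [Matrix.sum_mulVec, dotProduct_sum]
  refine Finset.sum_congr rfl fun i _ => ?_
  rw [smul_mulVec, dotProduct_smul, map_C_form, smul_eq_mul, mul_comm]

lemma eval_form (A0 : Matrix (Fin α) (Fin α) ℝ) (A : Fin n → Matrix (Fin α) (Fin α) ℝ)
    (x : Fin n → ℝ) (b : Fin α → ℝ) :
    b ⬝ᵥ (pencilEval A0 A x *ᵥ b) = (bv A0 A b b).1 + ∑ i, x i * (bv A0 A b b).2 i := by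
  simp only [pencilEval, add_mulVec, dotProduct_add, bv_apply]
  congr 1
  rw [Matrix.sum_mulVec, dotProduct_sum]
  refine Finset.sum_congr rfl fun i _ => ?_
  rw [smul_mulVec, dotProduct_smul, smul_eq_mul]

lemma pencil_psd_iff (A0 : Matrix (Fin α) (Fin α) ℝ) (A : Fin n → Matrix (Fin α) (Fin α) ℝ)
    (hA0 : A0.IsSymm) (hA : ∀ i, (A i).IsSymm) (x : Fin n → ℝ) :
    (pencilEval A0 A x).PosSemidef ↔
      ∀ b, 0 ≤ (bv A0 A b b).1 + ∑ i, x i * (bv A0 A b b).2 i := by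
  rw [posSemidef_iff_dotProduct_mulVec]
  constructor
  · rintro ⟨-, h⟩ b
    simpa [eval_form] using h b
  · intro h
    refine ⟨?_, fun b => by simpa [eval_form] using h b⟩
    have : (pencilEval A0 A x).IsSymm := by
      unfold pencilEval
      rw [Matrix.IsSymm, transpose_add, transpose_sum, hA0.eq]
      congr 1
      refine Finset.sum_congr rfl fun i _ => ?_
      rw [transpose_smul, (hA i).eq]
    rw [Matrix.IsHermitian, conjTranspose_eq_transpose_of_trivial]
    exact this

lemma lin_bv_mem (A0 : Matrix (Fin α) (Fin α) ℝ) (A : Fin n → Matrix (Fin α) (Fin α) ℝ)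
    (b : Fin α → ℝ) : InQuadModule A0 A (lin n (bv A0 A b b)) := by
  rw [← form_eq_lin]
  exact quadForm_mem A0 A _

lemma func_apply (f : (ℝ × (Fin n → ℝ)) →ₗ[ℝ] ℝ) (e : ℝ × (Fin n → ℝ)) :
    f e = e.1 * f (1, 0) + ∑ i, e.2 i * f (0, Pi.single i 1) := by
  have : e = e.1 • ((1, 0) : ℝ × (Fin n → ℝ)) +
      ∑ i, e.2 i • ((0, Pi.single i 1) : ℝ × (Fin n → ℝ)) := by
    ext j
    · simp [Prod.fst_sum]
    · simp [Prod.snd_sum, Finset.sum_apply, Pi.single_apply]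
  conv_lhs => rw [this]
  simp only [map_add, map_sum, map_smul, smul_eq_mul]

/-- Expansion of the quadratic form at `p b + s c`. -/
lemma quad_expand (A0 : Matrix (Fin α) (Fin α) ℝ) (A : Fin n → Matrix (Fin α) (Fin α) ℝ)
    (hA0 : A0.IsSymm) (hA : ∀ i, (A i).IsSymm) (b c : Fin α → ℝ) (p s : RP n) :
    quadForm (pencilPoly A0 A) (p • (fun i => C (b i)) + s • (fun i => C (c i))) =
      p ^ 2 * lin n (bv A0 A b b) + 2 * p * s * lin n (bv A0 A b c)
        + s ^ 2 * lin n (bv A0 A c c) := by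
  simp only [quadForm, mulVec_add, mulVec_smul, dotProduct_add, add_dotProduct, dotProduct_smul,
    smul_dotProduct, form_eq_lin, smul_eq_mul]
  rw [bv_symm A0 A hA0 hA c b]
  ring

end pencil

section final
variable {n α : ℕ}

lemma feasible_of_max (A0 : Matrix (Fin α) (Fin α) ℝ) (A : Fin n → Matrix (Fin α) (Fin α) ℝ)
    (hA0 : A0.IsSymm) (hA : ∀ i, (A i).IsSymm) {M : Set (RP n)} (h : MaxQM M)
    (hsub : ∀ p, InQuadModule A0 A p → p ∈ M) : ∃ x, (pencilEval A0 A x).PosSemidef := by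
  -- the affine-linear part of the support
  let W : Submodule ℝ (ℝ × (Fin n → ℝ)) :=
    { carrier := {e | lin n e ∈ M ∧ -lin n e ∈ M}
      add_mem' := by
        rintro a b ⟨h1, h2⟩ ⟨h3, h4⟩
        refine ⟨by rw [map_add]; exact h.add _ _ h1 h3, ?_⟩
        rw [map_add, neg_add]; exact h.add _ _ h2 h4
      zero_mem' := by simpa using h.zero
      smul_mem' := by
        rintro c a ⟨h1, h2⟩
        refine ⟨by rw [lin_smul]; exact h.supp_mul h1 h2 _, ?_⟩
        rw [lin_smul, ← mul_neg]
        exact h.supp_mul h2 (by simpa using h1) _ }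
  have hWmem : ∀ e, e ∈ W ↔ lin n e ∈ M ∧ -lin n e ∈ M := fun e => Iff.rfl
  let N : Submodule ℝ (Fin α → ℝ) :=
    { carrier := {b | ∀ c, bv A0 A b c ∈ W}
      add_mem' := by
        intro a b ha hb c
        rw [map_add, LinearMap.add_apply]; exact W.add_mem (ha c) (hb c)
      zero_mem' := by intro c; simp
      smul_mem' := by
        intro r a ha c
        rw [map_smul, LinearMap.smul_apply]; exact W.smul_mem _ (ha c) }
  have hNmem : ∀ b, b ∈ N ↔ ∀ c, bv A0 A b c ∈ W := fun b => Iff.rfl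
  have hN : ∀ b, bv A0 A b b ∈ W → b ∈ N := by
    intro b hb
    rw [hNmem]
    intro c
    obtain ⟨h1, h2⟩ := (hWmem _).1 hb
    set q := lin n (bv A0 A b b)
    set l := lin n (bv A0 A b c) with hl
    set r := lin n (bv A0 A c c)
    have hq := hsub _ (quadForm_mem A0 A
      ((-(C (1/2) * (r + 1))) • (fun i => C (b i)) + l • (fun i => C (c i))))
    rw [quad_expand A0 A hA0 hA] at hq
    have hneg : -l ^ 2 ∈ M := by
      convert h.add _ _ hq (h.mul (C (1/2) * (r + 1)) _ h2) using 1
      linear_combination (r + 1) * l ^ 2 * half_eq n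
    refine (hWmem _).2 ⟨h.supp_of_sq hneg, h.supp_of_sq (by rwa [neg_sq])⟩
  obtain ⟨N', hN'⟩ := Submodule.exists_isCompl N
  let Q0 : Set (ℝ × (Fin n → ℝ)) :=
    insert (1, 0) ((fun b => bv A0 A b b) '' (Metric.sphere 0 1 ∩ (N' : Set (Fin α → ℝ))))
  have hcont : Continuous fun b => bv A0 A b b := by
    simp only [bv_apply, dotProduct, mulVec]
    fun_prop
  have hQ0 : IsCompact Q0 :=
    (((isCompact_sphere 0 1).inter_right N'.closed_of_finiteDimensional).image hcont).insert _
  have hQ0M : ∀ z ∈ Q0, lin n z ∈ M := by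
    rintro z (rfl | ⟨b, -, rfl⟩)
    · rw [lin_one]; exact h.one
    · exact hsub _ (lin_bv_mem A0 A b)
  have hQ0W : ∀ z ∈ Q0, z ∉ W := by
    rintro z (rfl | ⟨b, ⟨hb1, hb2⟩, rfl⟩) hz
    · have := ((hWmem _).1 hz).2
      rw [lin_one] at this
      exact h.proper this
    · have hb0 : b = 0 := (Submodule.disjoint_def.1 hN'.disjoint) b (hN b hz) hb2
      rw [hb0] at hb1
      simp at hb1
  have hdisj : Disjoint (convexHull ℝ Q0) (W : Set (ℝ × (Fin n → ℝ))) := by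
    rw [Set.disjoint_left]
    intro x hx hxW
    obtain ⟨ι, _, z, w, hz, -, hw, hsum, hx⟩ := eq_pos_convex_span_of_mem_convexHull hx
    classical
    obtain ⟨i0⟩ : Nonempty ι := by
      by_contra hne
      rw [not_nonempty_iff] at hne
      simp at hsum
    have hzM : ∀ i, lin n (z i) ∈ M := fun i => hQ0M _ (hz ⟨i, rfl⟩)
    refine hQ0W _ (hz ⟨i0, rfl⟩) ((hWmem _).2 ⟨hzM i0, ?_⟩)
    have e : lin n x = C (w i0) * lin n (z i0)
        + ∑ i ∈ Finset.univ.erase i0, C (w i) * lin n (z i) := by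
      rw [Finset.add_sum_erase _ (fun i => C (w i) * lin n (z i)) (Finset.mem_univ i0), ← hx,
        map_sum]
      simp only [lin_smul]
    have m1 : ∑ i ∈ Finset.univ.erase i0, C (w i) * lin n (z i) ∈ M :=
      h.sum _ _ fun i _ => h.smul (hw i).le (hzM i)
    have m2 := h.smul (c := (w i0)⁻¹) (inv_nonneg.2 (hw i0).le)
      (h.add _ _ m1 ((hWmem _).1 hxW).2)
    convert m2 using 1
    have r : (C (w i0)⁻¹ : RP n) * C (w i0) = 1 := by
      rw [← C_mul, inv_mul_cancel₀ (hw i0).ne', C_1]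
    rw [e]
    linear_combination lin n (z i0) * r
  obtain ⟨f, u, v, hf1, huv, hf2⟩ := geometric_hahn_banach_compact_closed
    (convex_convexHull ℝ Q0) (compact_hull hQ0) W.convex W.closed_of_finiteDimensional hdisj
  have hv : v < 0 := by simpa using hf2 0 W.zero_mem
  have hfW : ∀ e ∈ W, f e = 0 := by
    intro e he
    by_contra hne
    have := hf2 ((v / f e) • e) (W.smul_mem _ he)
    rw [map_smul, smul_eq_mul, div_mul_cancel₀ _ hne] at this
    exact lt_irrefl _ this
  have hfQ : ∀ z ∈ Q0, f z < 0 := fun z hz => by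
    have := hf1 z (subset_convexHull ℝ Q0 hz)
    linarith
  have hf10 : f (1, 0) < 0 := hfQ _ (Set.mem_insert _ _)
  have hfN' : ∀ b ∈ N', f (bv A0 A b b) ≤ 0 := by
    intro b hb
    by_cases hb0 : b = 0
    · simp [hb0]
    · have hnb : 0 < ‖b‖ := norm_pos_iff.2 hb0
      have := hfQ (bv A0 A (‖b‖⁻¹ • b) (‖b‖⁻¹ • b)) (Set.mem_insert_of_mem _
        ⟨_, ⟨by simp [norm_smul, hnb.ne'], N'.smul_mem _ hb⟩, rfl⟩)
      simp only [map_smul, LinearMap.smul_apply, smul_eq_mul] at this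
      by_contra! hpos
      have : 0 < ‖b‖⁻¹ * (‖b‖⁻¹ * f (bv A0 A b b)) := by positivity
      linarith
  have hfall : ∀ b, f (bv A0 A b b) ≤ 0 := by
    intro b
    obtain ⟨b1, hb1, b2, hb2, rfl⟩ : ∃ b1 ∈ N, ∃ b2 ∈ N', b1 + b2 = b := by
      have : b ∈ N ⊔ N' := by rw [hN'.sup_eq_top]; trivial
      exact Submodule.mem_sup.1 this
    have e1 := hfW _ ((hNmem _).1 hb1 b1)
    have e2 := hfW _ ((hNmem _).1 hb1 b2)
    have e3 := hfN' b2 hb2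
    simp only [map_add, LinearMap.add_apply]
    rw [bv_symm A0 A hA0 hA b2 b1]
    linarith
  refine ⟨fun i => f (0, Pi.single i 1) / f (1, 0), ?_⟩
  rw [pencil_psd_iff A0 A hA0 hA]
  intro b
  have e := func_apply (f : (ℝ × (Fin n → ℝ)) →ₗ[ℝ] ℝ) (bv A0 A b b)
  simp only [ContinuousLinearMap.coe_coe] at e
  have e2 : (bv A0 A b b).1 + ∑ i, f (0, Pi.single i 1) / f (1, 0) * (bv A0 A b b).2 i
      = f (bv A0 A b b) / f (1, 0) := by
    rw [e, add_div, mul_div_cancel_right₀ _ hf10.ne, Finset.sum_div]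
    congr 1
    refine Finset.sum_congr rfl fun i _ => ?_
    ring
  rw [e2]
  exact div_nonneg_of_nonpos (hfall b) hf10.le

lemma arch_of_bounded (A0 : Matrix (Fin α) (Fin α) ℝ) (A : Fin n → Matrix (Fin α) (Fin α) ℝ)
    (hA0 : A0.IsSymm) (hA : ∀ i, (A i).IsSymm)
    (hbdd : Bornology.IsBounded {x : Fin n → ℝ | (pencilEval A0 A x).PosSemidef})
    (x0 : Fin n → ℝ) (hx0 : (pencilEval A0 A x0).PosSemidef) (i : Fin n) :
    Bd {p | InQuadModule A0 A p} (X i : RP n) := by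
  have h := qm_pencil A0 A
  set M : Set (RP n) := {p | InQuadModule A0 A p} with hM
  let K : Set (ℝ × (Fin n → ℝ)) := {e | lin n e ∈ M}
  have hKadd : ∀ a ∈ K, ∀ b ∈ K, a + b ∈ K := by
    intro a ha b hb
    change lin n (a + b) ∈ M
    rw [map_add]; exact h.add _ _ ha hb
  have hKsmul : ∀ c : ℝ, 0 ≤ c → ∀ a ∈ K, c • a ∈ K := by
    intro c hc a ha
    change lin n (c • a) ∈ M
    rw [lin_smul]; exact h.smul hc ha
  have hKconv : Convex ℝ K := by
    intro a ha b hb s t hs ht _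
    exact hKadd _ (hKsmul s hs a ha) _ (hKsmul t ht b hb)
  have hK1 : ((1, 0) : ℝ × (Fin n → ℝ)) ∈ K := by
    change lin n (1, 0) ∈ M
    rw [lin_one]; exact h.one
  have hKbv : ∀ b, bv A0 A b b ∈ K := fun b => lin_bv_mem A0 A b
  -- no recession functional
  have hno : ∀ g : (ℝ × (Fin n → ℝ)) →ₗ[ℝ] ℝ, g (1, 0) = 0 → (∀ e ∈ K, 0 ≤ g e) → g = 0 := by
    intro g hg1 hgK
    set d : Fin n → ℝ := fun i => g (0, Pi.single i 1) with hd
    have hd0 : d = 0 := by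
      by_contra hne
      have hnd : 0 < ‖d‖ := norm_pos_iff.2 hne
      obtain ⟨R, hR⟩ := hbdd.exists_norm_le
      have hmem : ∀ t : ℝ, 0 ≤ t → (pencilEval A0 A (x0 + t • d)).PosSemidef := by
        intro t ht
        rw [pencil_psd_iff A0 A hA0 hA] at hx0 ⊢
        intro b
        have h1 := hx0 b
        have h2 := hgK _ (hKbv b)
        rw [func_apply g, hg1, mul_zero, zero_add] at h2
        have e : ∑ i, (x0 + t • d) i * (bv A0 A b b).2 i = ∑ i, x0 i * (bv A0 A b b).2 i
            + t * ∑ i, (bv A0 A b b).2 i * g (0, Pi.single i 1) := by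
          rw [Finset.mul_sum, ← Finset.sum_add_distrib]
          refine Finset.sum_congr rfl fun i _ => ?_
          simp only [Pi.add_apply, Pi.smul_apply, smul_eq_mul, hd]
          ring
        rw [e]
        have := mul_nonneg ht h2
        linarith
      have hR0 : ‖x0‖ ≤ R := hR _ hx0
      have hRn : 0 ≤ R := (norm_nonneg _).trans hR0
      have ht0 : 0 ≤ (2 * R + 1) / ‖d‖ := by positivity
      have h3 := hR _ (hmem ((2 * R + 1) / ‖d‖) ht0)
      have h4 : ‖((2 * R + 1) / ‖d‖) • d‖ = 2 * R + 1 := by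
        rw [norm_smul, Real.norm_of_nonneg ht0, div_mul_cancel₀ _ hnd.ne']
      have h5 : ‖((2 * R + 1) / ‖d‖) • d‖ ≤ ‖x0 + ((2 * R + 1) / ‖d‖) • d‖ + ‖x0‖ := by
        have := norm_sub_le (x0 + ((2 * R + 1) / ‖d‖) • d) x0
        simpa using this
      linarith
    ext e
    · simpa using hg1
    · simpa using congrFun hd0 _
  have hint : ((1, 0) : ℝ × (Fin n → ℝ)) ∈ interior K := by
    have hne : (interior K).Nonempty := by
      rw [hKconv.interior_nonempty_iff_affineSpan_eq_top]
      have hspan : Submodule.span ℝ K = ⊤ := by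
        by_contra hlt
        obtain ⟨g, hg, hgk⟩ := Submodule.exists_le_ker_of_lt_top _ (lt_top_iff_ne_top.2 hlt)
        have hgz : ∀ e ∈ K, g e = 0 := fun e he => hgk (Submodule.subset_span he)
        exact hg (hno g (hgz _ hK1) fun e he => (hgz e he).ge)
      have h0 : (0 : ℝ × (Fin n → ℝ)) ∈ K := by
        simpa using hKsmul 0 le_rfl _ hK1
      rw [← SetLike.coe_set_eq, ← Set.insert_eq_of_mem h0, affineSpan_insert_zero, hspan]
      rfl
    by_contra hnot
    obtain ⟨g, hg⟩ := geometric_hahn_banach_open_point hKconv.interior isOpen_interior hnot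
    have hle : ∀ e ∈ K, g e ≤ g (1, 0) := by
      intro e he
      have hcl : e ∈ closure (interior K) := by
        rw [hKconv.closure_interior_eq_closure_of_nonempty_interior hne]
        exact subset_closure he
      have hclosed : IsClosed {e | g e ≤ g (1, 0)} := isClosed_le g.continuous continuous_const
      exact hclosed.closure_subset_iff.2 (fun a ha => (hg a ha).le) hcl
    have hg1 : g (1, 0) = 0 := by
      have a1 := hle _ (hKsmul 2 (by norm_num) _ hK1)
      have a2 := hle _ (hKsmul 0 le_rfl _ hK1)
      rw [map_smul, smul_eq_mul] at a1 a2
      linarith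
    have := hno (-(g : (ℝ × (Fin n → ℝ)) →ₗ[ℝ] ℝ)) (by simp [hg1]) (by
      intro e he
      have := hle e he
      simp only [LinearMap.neg_apply, ContinuousLinearMap.coe_coe]
      linarith)
    obtain ⟨a, ha⟩ := hne
    have h1 := hg a ha
    have h2 := LinearMap.congr_fun this a
    simp only [LinearMap.neg_apply, ContinuousLinearMap.coe_coe, LinearMap.zero_apply] at h2
    linarith
  obtain ⟨δ, hδ, hball⟩ := Metric.mem_nhds_iff.1 (mem_interior_iff_mem_nhds.1 hint)
  have key : ∀ t : ℝ, |t| = δ / 2 → C 1 + C t * X i ∈ M := by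
    intro t ht
    have hm : ((1, Pi.single i t) : ℝ × (Fin n → ℝ)) ∈ Metric.ball (1, 0) δ := by
      rw [Metric.mem_ball, dist_eq_norm]
      have : ((1, Pi.single i t) : ℝ × (Fin n → ℝ)) - (1, 0) = (0, Pi.single i t) := by simp
      rw [this, Prod.norm_mk, norm_zero, Pi.norm_single, Real.norm_eq_abs, ht]
      rw [max_lt_iff]; constructor <;> linarith
    have := hball hm
    change lin n (1, Pi.single i t) ∈ M at this
    convert this using 1
    rw [lin_apply]
    congr 1
    rw [Finset.sum_eq_single i]
    · simp
    · intro j _ hj; simp [Pi.single_eq_of_ne hj]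
    · simp
  have r : ∀ t : ℝ, t ≠ 0 → (C t⁻¹ : RP n) * C t = 1 := by
    intro t ht
    rw [← C_mul, inv_mul_cancel₀ ht, C_1]
  have hr := r (δ / 2) (by positivity)
  refine ⟨(δ / 2)⁻¹, by positivity, ?_, ?_⟩
  · have := h.smul (c := (δ / 2)⁻¹) (by positivity)
      (key (-(δ / 2)) (by rw [abs_neg, abs_of_pos (by positivity)]))
    convert this using 1
    rw [C_neg, C_1]
    linear_combination X i * hr
  · have := h.smul (c := (δ / 2)⁻¹) (by positivity)
      (key (δ / 2) (by rw [abs_of_pos (by positivity)]))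
    convert this using 1
    rw [C_1]
    linear_combination - X i * hr

end final

/-- Putinar-type Positivstellensatz for bounded spectrahedra: if `S_A` is bounded and
`f > 0` on `S_A`, then `f ∈ M_A`. -/
theorem stmt_18 {n α : ℕ} (A0 : Matrix (Fin α) (Fin α) ℝ)
    (A : Fin n → Matrix (Fin α) (Fin α) ℝ) (hA0 : A0.IsSymm) (hA : ∀ i, (A i).IsSymm)
    (hbdd : Bornology.IsBounded {x : Fin n → ℝ | (pencilEval A0 A x).PosSemidef})
    (f : RP n) (hf : ∀ x : Fin n → ℝ, (pencilEval A0 A x).PosSemidef → 0 < eval x f) :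
    InQuadModule A0 A f := by
  have h := qm_pencil A0 A
  by_cases hne : ∃ x, (pencilEval A0 A x).PosSemidef
  · obtain ⟨x0, hx0⟩ := hne
    refine putinar h (arch_of_bounded A0 A hA0 hA hbdd x0 hx0) f fun x hx => hf x ?_
    rw [pencil_psd_iff A0 A hA0 hA]
    intro b
    have := hx _ (lin_bv_mem A0 A b)
    rwa [eval_lin] at this
  · refine h.all_of_neg_one ?_ f
    by_contra hp
    obtain ⟨M, hsub, hmax⟩ := exists_max h hp
    exact hne (feasible_of_max A0 A hA0 hA hmax fun p hp => hsub hp)
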